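/- Let g : F_q^p → F_q be a function of degree at least q(p−1), i.e., every polynomial over F_q whose evaluation equals g has total degree at least q(p−1). Then: (1) there exists an invertible affine map T₁ : F_q^p → F_q^p such that the unique polynomial with all individual variable degrees at most q−1 representing g∘T₁ has a nonzero coefficient on some monomial Π_{i=1}^{p} x_i^{e_i} with q − q/p ≤ e_i ≤ q−1 for every i; and (2) there exists an invertible affine map T₂ : F_q^p → F_q^p such that ⟨g∘T₂, P⟩ ≠ 0, where P is evaluated as a function F_q^p → F_q. -/

import Mathlib

noncomputable section

open Finset

/-- Affine maps `F^ℓ → F^n`, given as a pair (linear part matrix, translation). -/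
abbrev Aff (F : Type) (n ℓ : ℕ) := Matrix (Fin n) (Fin ℓ) F × (Fin n → F)

/-- Application of an affine map `T = (M, c)`: `x ↦ Mx + c`. -/
def affApp {F : Type} [Field F] {n ℓ : ℕ} (T : Aff F n ℓ) (x : Fin ℓ → F) : Fin n → F :=
  T.1.mulVec x + T.2

/-- Inner product of two functions `F^m → F`. -/
def ip {F : Type} [Field F] [Fintype F] {m : ℕ} (u v : (Fin m → F) → F) : F :=
  ∑ z : Fin m → F, u z * v z

/-- `g` has degree at most `d` as a function. -/
def fDegLE {F : Type} [Field F] {m : ℕ} (g : (Fin m → F) → F) (d : ℕ) : Prop :=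
  ∃ Q : MvPolynomial (Fin m) F, Q.totalDegree ≤ d ∧ ∀ x, MvPolynomial.eval x Q = g x

/-- The defining equation of the polynomial `P`:
`x_1 ⋯ x_{p-1} · P = ∑_{I ⊆ [p-1]} (-1)^{|I|+1} (x_I + x_p)^{q-1}`. -/
def Pdef {F : Type} [Field F] (p q : ℕ) (hp : 0 < p) (P : MvPolynomial (Fin p) F) : Prop :=
  (∏ i : Fin (p - 1), MvPolynomial.X (Fin.castLE (Nat.sub_le p 1) i)) * P =
    ∑ I : Finset (Fin (p - 1)),
      MvPolynomial.C ((-1 : F) ^ (I.card + 1)) *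
        ((∑ i ∈ I, MvPolynomial.X (Fin.castLE (Nat.sub_le p 1) i)) +
          MvPolynomial.X (⟨p - 1, Nat.sub_lt hp one_pos⟩ : Fin p)) ^ (q - 1)

/-- The test polynomial `H_e` as a function on `F^{s+t}`. -/
def Hfun {F : Type} [Field F] {p : ℕ} (P : MvPolynomial (Fin p) F)
    (s t : ℕ) (e : Fin t → ℕ) (x : Fin (s + t) → F) : F :=
  (∏ i ∈ Finset.range (s / p),
    MvPolynomial.eval (fun l : Fin p =>
      if h : p * i + (l : ℕ) < s + t then x ⟨p * i + (l : ℕ), h⟩ else 0) P) *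
  ∏ j : Fin t, x (Fin.natAdd s j) ^ e j

/-- A degree sequence `e ∈ {0, …, q-1}^t` is valid if `∑ e_j ≤ t(q-1) - r`. -/
def validE (q r t : ℕ) (e : Fin t → ℕ) : Prop :=
  (∀ j, e j ≤ q - 1) ∧ ∑ j, e j ≤ t * (q - 1) - r

/-- `T` rejects `f` in the sparse `(s+t)`-flat test. -/
def rejects {F : Type} [Field F] [Fintype F] {p : ℕ} (P : MvPolynomial (Fin p) F)
    (q s r t n : ℕ) (f : (Fin n → F) → F) (T : Aff F n (s + t)) : Prop :=
  ∃ e : Fin t → ℕ, validE q r t e ∧ ip (fun x => f (affApp T x)) (Hfun P s t e) ≠ 0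

/-- Density of `A` inside `C`. -/
def dens {α : Type} (A C : Set α) : ℝ :=
  (Nat.card ↥(A ∩ C) : ℝ) / (Nat.card ↥C : ℝ)

/-- Fractional measure of a set in a (finite) type. -/
def mu {α : Type} (A : Set α) : ℝ :=
  (Nat.card ↥A : ℝ) / (Nat.card α : ℝ)

/-- The union of the supports of the test polynomials `H_e`. -/
def suppH {F : Type} [Field F] [Fintype F] {p : ℕ} (P : MvPolynomial (Fin p) F)
    (q s t : ℕ) : Set (Fin (s + t) → F) :=
  {x | ∃ e : Fin t → ℕ, (∀ j, e j ≤ q - 1) ∧ Hfun P s t e x ≠ 0}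

/-- Edge expansion of a set `S` in the (regular) graph with adjacency `adj`:
the probability that a uniformly random step started in `S` escapes `S`. -/
def expans {α : Type} (adj : α → α → Prop) (S : Set α) : ℝ :=
  (Nat.card {x : α × α // x.1 ∈ S ∧ adj x.1 x.2 ∧ x.2 ∉ S} : ℝ) /
  (Nat.card {x : α × α // x.1 ∈ S ∧ adj x.1 x.2} : ℝ)

/-- Adjacency in the affine bi-linear scheme graph: two distinct affine maps are adjacent
iff their agreement set is an affine subspace of dimension `ℓ - 1`. -/
def adjBilin {F : Type} [Field F] {n ℓ : ℕ} (T₁ T₂ : Aff F n ℓ) : Prop :=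
  T₁ ≠ T₂ ∧ ∃ W : AffineSubspace F (Fin ℓ → F),
    (W : Set (Fin ℓ → F)).Nonempty ∧
    (W : Set (Fin ℓ → F)) = {x | affApp T₁ x = affApp T₂ x} ∧
    Module.finrank F W.direction = ℓ - 1

/-- `W` is an `ℓ`-flat: a nonempty affine subspace of dimension `ℓ`. -/
def IsFlat {F : Type} [Field F] {N : ℕ} (ℓ : ℕ) (W : AffineSubspace F (Fin N → F)) : Prop :=
  (W : Set (Fin N → F)).Nonempty ∧ Module.finrank F W.direction = ℓ

/-- Adjacency in the affine Grassmann graph `AffGras(N, ℓ)`: two distinct `ℓ`-flats are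
adjacent iff their intersection is an `(ℓ-1)`-flat. -/
def adjGras {F : Type} [Field F] {N : ℕ} (ℓ : ℕ) (U V : AffineSubspace F (Fin N → F)) : Prop :=
  U ≠ V ∧ IsFlat ℓ U ∧ IsFlat ℓ V ∧ IsFlat (ℓ - 1) (U ⊓ V)

/-- The minimal fractional Hamming distance from `f` to a function of degree at most `d`. -/
def deltaDist {F : Type} [Field F] [Fintype F] {n : ℕ} (f : (Fin n → F) → F) (d : ℕ) : ℝ :=
  sInf {x : ℝ | ∃ g : (Fin n → F) → F, fDegLE g d ∧
    x = (Nat.card {y : Fin n → F // f y ≠ g y} : ℝ) / (Fintype.card (Fin n → F) : ℝ)}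

theorem Finset.sum_pow_card_sub_one {F : Type*} [Field F] [Fintype F] (n : ℕ)
    (hn : n < 2 * (Fintype.card F - 1)) :
    ∑ x : F, x ^ n = if n = Fintype.card F - 1 then -1 else 0 := by
  classical
  have h1 : 1 < Fintype.card F := Fintype.one_lt_card
  split_ifs with h
  · subst h
    have : ∀ x : F, x ^ (Fintype.card F - 1) = 1 - if x = 0 then 1 else 0 := by
      intro x
      split_ifs with hx
      · subst hx; simp [show Fintype.card F - 1 ≠ 0 by omega]
      · simp [FiniteField.pow_card_sub_one_eq_one x hx]
    simp [this]
  · rcases lt_or_ge n (Fintype.card F - 1) with h' | h'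
    · exact FiniteField.sum_pow_lt_card_sub_one F n h'
    · obtain ⟨m, rfl⟩ := Nat.exists_eq_add_of_le h'
      rw [← FiniteField.sum_pow_lt_card_sub_one F m (by omega)]
      refine Finset.sum_congr rfl fun x _ => ?_
      rcases eq_or_ne x 0 with rfl | hx
      · simp [show m ≠ 0 by omega, show Fintype.card F - 1 ≠ 0 by omega]
      · rw [pow_add, FiniteField.pow_card_sub_one_eq_one x hx, one_mul]

theorem Nat.Prime.not_dvd_pow_sub_one_choose {p : ℕ} (hp : p.Prime) (k h : ℕ)
    (hh : h ≤ p ^ k - 1) : ¬ p ∣ (p ^ k - 1).choose h := by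
  induction h with
  | zero => simpa using hp.one_lt.ne'
  | succ h ih =>
    intro hd
    have h0 : 0 < p ^ k := Nat.pow_pos hp.pos
    have h1 : p ∣ (p ^ k).choose (h + 1) := hp.dvd_choose_pow (by omega) (by omega)
    rw [show p ^ k = p ^ k - 1 + 1 by omega, Nat.choose_succ_succ] at h1
    exact ih (by omega) ((Nat.dvd_add_left hd).1 h1)

theorem padicValNat_factorial_prime_pow_succ (p n : ℕ) [Fact p.Prime] :
    padicValNat p (p ^ (n + 1)).factorial = 1 + p * padicValNat p (p ^ n).factorial := by
  have h (n : ℕ) : padicValNat p (p ^ (n + 1)).factorial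
      = padicValNat p (p ^ n).factorial + p ^ n := by
    rw [pow_succ', padicValNat_factorial_mul]
  induction n with
  | zero => rw [h]; simp
  | succ n ih => rw [h (n + 1), ih, add_assoc, pow_succ', ← mul_add, ← h, ih]

theorem Nat.Prime.not_dvd_multinomial_pow {p : ℕ} (hp : p.Prime) (k : ℕ) (j : Fin p)
    (a : Fin p →₀ ℕ) (haj : a j = p ^ k - 1) (ha : ∀ i ≠ j, a i = p ^ k) :
    ¬ p ∣ a.multinomial := by
  have : Fact p.Prime := ⟨hp⟩
  have h0 : 0 < p ^ k := Nat.pow_pos hp.pos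
  have hsum : ∑ i, a i + 1 = p ^ (k + 1) := by
    rw [← Finset.add_sum_erase _ _ (Finset.mem_univ j),
      Finset.sum_congr rfl (fun i hi => ha i (Finset.ne_of_mem_erase hi)), haj]
    simp only [Finset.sum_const, Finset.card_erase_of_mem (Finset.mem_univ j), Finset.card_univ,
      Fintype.card_fin, smul_eq_mul]
    obtain ⟨m, rfl⟩ : ∃ m, p = m + 1 := ⟨p - 1, by have := hp.pos; omega⟩
    rw [pow_succ]
    simp only [Nat.add_sub_cancel]
    nlinarith [Nat.sub_add_cancel h0]
  have hprod : (∏ i, (a i).factorial) * p ^ k = (p ^ k).factorial ^ p := by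
    rw [← Finset.mul_prod_erase _ _ (Finset.mem_univ j),
      Finset.prod_congr rfl (fun i hi => by rw [ha i (Finset.ne_of_mem_erase hi)]), haj]
    simp only [Finset.prod_const, Finset.card_erase_of_mem (Finset.mem_univ j), Finset.card_univ,
      Fintype.card_fin]
    rw [mul_right_comm, mul_comm _ (p ^ k), Nat.mul_factorial_pred h0.ne', ← pow_succ',
      Nat.succ_eq_add_one, Nat.sub_add_cancel hp.one_le]
  have key : p * ((p ^ k).factorial ^ p * a.multinomial) = (p ^ (k + 1)).factorial := by
    rw [Finsupp.multinomial_eq_of_support_subset (Finset.subset_univ _), ← hprod, mul_right_comm,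
      Nat.multinomial_spec, ← Nat.mul_factorial_pred (pow_ne_zero (k + 1) hp.ne_zero), ← hsum,
      Nat.add_sub_cancel, hsum]
    ring
  have hm : a.multinomial ≠ 0 := by
    rw [Finsupp.multinomial_eq_of_support_subset (Finset.subset_univ _)]
    exact (Nat.multinomial_pos _ _).ne'
  have hv := congrArg (padicValNat p) key
  rw [padicValNat_factorial_prime_pow_succ, padicValNat.mul hp.ne_zero
    (mul_ne_zero (pow_ne_zero _ (Nat.factorial_ne_zero _)) hm),
    padicValNat.mul (pow_ne_zero _ (Nat.factorial_ne_zero _)) hm, padicValNat.pow, padicValNat.self hp.one_lt] at hv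
  intro hd
  have := one_le_padicValNat_of_dvd hm hd
  omega

open MvPolynomial in
theorem Pdef.coeff_eq {F : Type} [Field F] {n q : ℕ} {h : 0 < n + 1}
    {P : MvPolynomial (Fin (n + 1)) F} (hP : Pdef (n + 1) q h P) (m a : Fin (n + 1) →₀ ℕ)
    (ha : ∀ i : Fin n, a i.castSucc = m i.castSucc + 1)
    (hlast : a (Fin.last n) = m (Fin.last n)) :
    coeff m P = if ∑ i, a i = q - 1 then (-1) ^ (n + 1) * (a.multinomial : F) else 0 := by
  have hX : (∏ i : Fin n, (X i.castSucc : MvPolynomial (Fin (n + 1)) F))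
      = monomial (∑ i : Fin n, Finsupp.single i.castSucc 1) 1 := by
    rw [monomial_sum_one]; rfl
  have hs : a = (∑ i : Fin n, Finsupp.single i.castSucc 1) + m := by
    ext l
    refine Fin.lastCases ?_ (fun i => ?_) l
    · simp [hlast, Fin.castSucc_ne_last]
    · simp [ha, Finsupp.single_apply, add_comm]
  have hlin (I : Finset (Fin n)) : (∑ i ∈ I, X i.castSucc) + X (Fin.last n) =
      ∑ l, (Fin.snoc (fun i => if i ∈ I then 1 else 0) 1 : Fin (n + 1) → F) l •
        (X l : MvPolynomial (Fin (n + 1)) F) := by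
    simp [Fin.sum_univ_castSucc]
  have hP' : (∏ i : Fin n, X i.castSucc) * P = ∑ I : Finset (Fin n),
      C ((-1 : F) ^ (I.card + 1)) * ((∑ i ∈ I, X i.castSucc) + X (Fin.last n)) ^ (q - 1) := hP
  have hc := congrArg (coeff a) hP'
  rw [hX, hs, coeff_monomial_mul, ← hs, one_mul] at hc
  rw [hc]
  simp_rw [hlin, coeff_sum, coeff_C_mul, coeff_linearCombination_X_pow_of_fintype]
  rw [Finsupp.sum_fintype _ _ (by simp)]
  split_ifs with hd
  · rw [Finset.sum_eq_single Finset.univ]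
    · rw [Finsupp.prod_fintype _ _ (by simp)]
      simp [Fin.prod_univ_castSucc]
    · intro I _ hI
      obtain ⟨i, hi⟩ : ∃ i, i ∉ I := by
        by_contra! hall
        exact hI (Finset.eq_univ_iff_forall.2 hall)
      rw [Finsupp.prod_fintype _ _ (by simp),
        Finset.prod_eq_zero (Finset.mem_univ i.castSucc) (by simp [hi, ha])]
      simp
    · simp
  · simp

theorem Pdef.coeff_const_ne_zero {F : Type} [Field F] {p k : ℕ} [CharP F p] (hp : p.Prime)
    {P : MvPolynomial (Fin p) F} (hP : Pdef p (p ^ (k + 1)) hp.pos P)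
    (b : Fin p →₀ ℕ) (hb : ∀ i, b i = p ^ k - 1) : MvPolynomial.coeff b P ≠ 0 := by
  obtain ⟨n, rfl⟩ : ∃ n, p = n + 1 := ⟨p - 1, by have := hp.pos; omega⟩
  have h0 : 0 < (n + 1) ^ k := Nat.pow_pos hp.pos
  set a : Fin (n + 1) →₀ ℕ := Finsupp.equivFunOnFinite.symm
    (Fin.snoc (fun _ => (n + 1) ^ k) ((n + 1) ^ k - 1)) with hadef
  have ha1 (i : Fin n) : a i.castSucc = (n + 1) ^ k := by simp [hadef]
  have ha2 : a (Fin.last n) = (n + 1) ^ k - 1 := by simp [hadef]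
  rw [hP.coeff_eq b a (fun i => by rw [ha1, hb]; omega) (by rw [ha2, hb]), if_pos]
  · refine mul_ne_zero (pow_ne_zero _ (by simp)) ?_
    rw [Ne, CharP.cast_eq_zero_iff F (n + 1)]
    refine hp.not_dvd_multinomial_pow k (Fin.last n) a ha2 fun i hi => ?_
    obtain ⟨j, rfl⟩ := Fin.exists_castSucc_eq.2 hi
    exact ha1 j
  · rw [Fin.sum_univ_castSucc]
    simp only [ha1, ha2]
    simp only [Finset.sum_const, Finset.card_univ, Fintype.card_fin, smul_eq_mul]
    rw [pow_succ', add_mul]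
    omega

theorem Pdef.lt_of_mem_support {F : Type} [Field F] {p q : ℕ} (hp : 2 ≤ p) {h : 0 < p}
    {P : MvPolynomial (Fin p) F} (hP : Pdef p q h P) {m : Fin p →₀ ℕ} (hm : m ∈ P.support)
    (i : Fin p) : m i < q - 1 := by
  obtain ⟨n, rfl⟩ : ∃ n, p = n + 1 := ⟨p - 1, by omega⟩
  set a : Fin (n + 1) →₀ ℕ := Finsupp.equivFunOnFinite.symm
    (Fin.snoc (fun i => m i.castSucc + 1) (m (Fin.last n))) with hadef
  have ha1 (i : Fin n) : a i.castSucc = m i.castSucc + 1 := by simp [hadef]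
  have ha2 : a (Fin.last n) = m (Fin.last n) := by simp [hadef]
  rw [MvPolynomial.mem_support_iff, hP.coeff_eq m a ha1 ha2] at hm
  have hsum : ∑ i, a i = q - 1 := by
    by_contra hne
    simp [hne] at hm
  rw [Fin.sum_univ_castSucc] at hsum
  simp only [ha1, ha2, Finset.sum_add_distrib, Finset.sum_const, Finset.card_univ,
    Fintype.card_fin, smul_eq_mul, mul_one] at hsum
  have : m i ≤ ∑ i, m i := Finset.single_le_sum (fun _ _ => Nat.zero_le _) (Finset.mem_univ i)
  rw [Fin.sum_univ_castSucc] at this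
  omega

theorem ip_eval_mono {F : Type} [Field F] [Fintype F] {n : ℕ} (R : MvPolynomial (Fin n) F)
    (hR : ∀ m ∈ R.support, ∀ i, m i ≤ Fintype.card F - 1) (e c : Fin n →₀ ℕ)
    (he : ∀ i, 1 ≤ e i) (hec : ∀ i, e i + c i = Fintype.card F - 1) :
    ip (fun z => MvPolynomial.eval z R) (fun z => ∏ i, z i ^ c i) =
      (-1) ^ n * MvPolynomial.coeff e R := by
  have hmono (m : Fin n →₀ ℕ) (hm : m ∈ R.support) :
      ∑ z : Fin n → F, (∏ i, z i ^ m i) * ∏ i, z i ^ c i = if m = e then (-1) ^ n else 0 := by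
    simp_rw [← Finset.prod_mul_distrib, ← pow_add]
    rw [← Fintype.piFinset_univ, ← Finset.prod_univ_sum (fun _ => Finset.univ)
      (fun i x => x ^ (m i + c i))]
    have hlt (i : Fin n) : m i + c i < 2 * (Fintype.card F - 1) := by
      have := hR m hm i; have := he i; have := hec i; omega
    simp_rw [Finset.sum_pow_card_sub_one _ (hlt _)]
    split_ifs with h
    · subst h; simp [hec]
    · obtain ⟨i, hi⟩ := DFunLike.ne_iff.1 h
      refine Finset.prod_eq_zero (Finset.mem_univ i) (if_neg ?_)
      have := hec i
      omega
  simp only [ip, MvPolynomial.eval_eq', Finset.sum_mul, mul_assoc]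
  rw [Finset.sum_comm]
  simp_rw [← Finset.mul_sum]
  rw [Finset.sum_congr rfl fun m hm => by rw [hmono m hm]]
  simp [mul_comm]

/-- `f` is orthogonal to `g ∘ T` for every invertible affine map `T`. -/
def AffOrthogonal {F : Type} [Field F] [Fintype F] {n : ℕ} (g f : (Fin n → F) → F) : Prop :=
  ∀ T : Aff F n n, IsUnit T.1 → ip (fun x => g (affApp T x)) f = 0

namespace AffOrthogonal

variable {F : Type} [Field F] [Fintype F] {n : ℕ} {g f : (Fin n → F) → F}

theorem comp (hf : AffOrthogonal g f) {S : Aff F n n} (hS : IsUnit S.1) :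
    AffOrthogonal g (fun z => f (affApp S z)) := by
  intro T hT
  have hdet : IsUnit S.1.det := (Matrix.isUnit_iff_isUnit_det _).1 hS
  have hinv (z : Fin n → F) :
      affApp (T.1 * S.1⁻¹, T.2 - (T.1 * S.1⁻¹).mulVec S.2) (affApp S z) = affApp T z := by
    simp only [affApp, Matrix.mulVec_add, Matrix.mulVec_mulVec,
      Matrix.nonsing_inv_mul_cancel_right _ T.1 hdet]
    abel
  have hbij : Function.Bijective (affApp S) := by
    rw [← Finite.injective_iff_bijective]
    intro x y hxy
    exact Matrix.mulVec_injective_of_isUnit hS (add_right_cancel hxy)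
  rw [← hf (T.1 * S.1⁻¹, T.2 - (T.1 * S.1⁻¹).mulVec S.2)
    (hT.mul ((Matrix.isUnit_nonsing_inv_iff).2 hS))]
  simp only [ip, ← hinv]
  exact hbij.sum_comp (fun y => g (affApp _ y) * f y)

theorem shear {j : Fin n} {N h : ℕ} {R u : (Fin n → F) → F} (hN : N < Fintype.card F)
    (hR : ∀ z t, R (Function.update z j t) = R z)
    (hu : ∀ t : F, ∃ S : Aff F n n, IsUnit S.1 ∧
      ∀ z, affApp S z = Function.update z j (z j + t * u z))
    (hf : AffOrthogonal g (fun z => z j ^ N * R z)) (hh : h ≤ N) (hc : (N.choose h : F) ≠ 0) :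
    AffOrthogonal g (fun z => z j ^ (N - h) * u z ^ h * R z) := by
  intro T hT
  set L : ℕ → F := fun m =>
    ip (fun x => g (affApp T x)) (fun z => z j ^ (N - m) * u z ^ m * R z) with hL
  let A : Polynomial F := ∑ m ∈ range (N + 1), Polynomial.monomial m ((N.choose m : F) * L m)
  have hA : A = 0 := by
    refine Polynomial.eq_zero_of_natDegree_lt_card_of_eval_eq_zero A Function.injective_id
      (fun t => ?_) (lt_of_le_of_lt ?_ hN)
    · obtain ⟨S, hS, hSz⟩ := hu t
      have h0 := hf.comp hS T hT
      simp only [hSz, Function.update_self, hR] at h0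
      rw [← h0]
      simp only [A, hL, ip, Polynomial.eval_finsetSum, Polynomial.eval_monomial, id]
      simp_rw [Finset.mul_sum, Finset.sum_mul]
      rw [Finset.sum_comm]
      refine Finset.sum_congr rfl fun z _ => ?_
      rw [add_comm (z j), add_pow, Finset.sum_mul, Finset.mul_sum]
      refine Finset.sum_congr rfl fun m _ => ?_
      rw [mul_pow]
      ring
    · refine Polynomial.natDegree_sum_le_of_forall_le _ _ fun m hm => ?_
      exact (Polynomial.natDegree_monomial_le _).trans (by simpa [Nat.lt_succ_iff] using hm)
  have hcoeff : A.coeff h = (N.choose h : F) * L h := by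
    simp only [A, Polynomial.finsetSum_coeff, Polynomial.coeff_monomial]
    rw [Finset.sum_ite_eq' (range (N + 1)) h, if_pos (by simpa [Nat.lt_succ_iff] using hh)]
  rw [hA, Polynomial.coeff_zero] at hcoeff
  exact (mul_eq_zero.1 hcoeff.symm).resolve_left hc

theorem translate {c : Fin n → ℕ} {j : Fin n} {h : ℕ} (hN : c j < Fintype.card F)
    (hf : AffOrthogonal g (fun z => ∏ i, z i ^ c i)) (hh : h ≤ c j)
    (hc : ((c j).choose h : F) ≠ 0) :
    AffOrthogonal g (fun z => ∏ i, z i ^ Function.update c j (c j - h) i) := by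
  have key := shear (g := g) (j := j) (R := fun z => ∏ i ∈ univ.erase j, z i ^ c i)
    (u := fun _ => 1) (h := h) hN
    (fun z t => Finset.prod_congr rfl fun i hi => by
      rw [Function.update_of_ne (Finset.ne_of_mem_erase hi)])
    (fun t => ⟨(1, Pi.single j t), isUnit_one, fun z => by
      ext i
      rcases eq_or_ne i j with rfl | hi
      · simp [affApp]
      · simp [affApp, hi]⟩)
    (by simpa only [Finset.mul_prod_erase univ (fun i => _ ^ c i) (mem_univ j)] using hf) hh hc
  convert key using 2 with z
  rw [← Finset.mul_prod_erase univ _ (mem_univ j), Function.update_self, one_pow, mul_one]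
  congr 1
  exact Finset.prod_congr rfl fun i hi => by
    rw [Function.update_of_ne (Finset.ne_of_mem_erase hi)]

theorem transvect {c : Fin n → ℕ} {i j : Fin n} (hij : i ≠ j) {h : ℕ} (hN : c j < Fintype.card F)
    (hf : AffOrthogonal g (fun z => ∏ l, z l ^ c l)) (hh : h ≤ c j)
    (hc : ((c j).choose h : F) ≠ 0) :
    AffOrthogonal g (fun z =>
      ∏ l, z l ^ Function.update (Function.update c j (c j - h)) i (c i + h) l) := by
  have key := shear (g := g) (j := j) (R := fun z => ∏ l ∈ univ.erase j, z l ^ c l)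
    (u := fun z => z i) (h := h) hN
    (fun z t => Finset.prod_congr rfl fun l hl => by
      rw [Function.update_of_ne (Finset.ne_of_mem_erase hl)])
    (fun t => ⟨(Matrix.transvection j i t, 0), by
      rw [Matrix.isUnit_iff_isUnit_det, Matrix.det_transvection_of_ne _ _ hij.symm]
      exact isUnit_one, fun z => by
      ext l
      rcases eq_or_ne l j with rfl | hl
      · simp [affApp, Matrix.transvection, Matrix.add_mulVec, Matrix.single_mulVec]
      · simp [affApp, Matrix.transvection, Matrix.add_mulVec, Matrix.single_mulVec, hl]⟩)
    (by simpa only [Finset.mul_prod_erase univ (fun i => _ ^ c i) (mem_univ j)] using hf) hh hc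
  have hi : i ∈ univ.erase j := by simp [hij]
  convert key using 2 with z
  rw [← Finset.mul_prod_erase univ _ (mem_univ j), ← Finset.mul_prod_erase _ _ hi,
    ← Finset.mul_prod_erase _ (fun l => z l ^ c l) hi, Function.update_self,
    Function.update_of_ne hij.symm, Function.update_self, pow_add,
    Finset.prod_congr rfl fun l hl => by
      rw [Function.update_of_ne (Finset.ne_of_mem_erase hl),
        Function.update_of_ne (Finset.ne_of_mem_erase (Finset.mem_of_mem_erase hl))]]
  ring

/-- Scaling the coordinates isolates the monomials of a polynomial. -/
theorem monomial_of_eval {P : MvPolynomial (Fin n) F}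
    (hP : ∀ m ∈ P.support, ∀ i, m i < Fintype.card F - 1)
    (hf : AffOrthogonal g (fun z => MvPolynomial.eval z P)) {b : Fin n →₀ ℕ}
    (hb : b ∈ P.support) : AffOrthogonal g (fun z => ∏ i, z i ^ b i) := by
  intro T hT
  set L : (Fin n →₀ ℕ) → F := fun m =>
    ip (fun x => g (affApp T x)) (fun z => ∏ i, z i ^ m i) with hL
  let s : Fin n →₀ ℕ := Finsupp.equivFunOnFinite.symm fun _ => 1
  let A : MvPolynomial (Fin n) F :=
    ∑ m ∈ P.support, MvPolynomial.monomial (m + s) (P.coeff m * L m)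
  have hA : A = 0 := by
    refine MvPolynomial.eq_zero_of_eval_eq_zero (Fin n) F A (fun t => ?_) ?_
    · by_cases ht : ∀ i, t i ≠ 0
      · have h0 := hf.comp (S := (Matrix.diagonal t, 0)) (by
          rw [Matrix.isUnit_iff_isUnit_det, Matrix.det_diagonal]
          exact (Finset.prod_ne_zero_iff.2 fun i _ => ht i).isUnit) T hT
        have : MvPolynomial.eval t A = (∏ i, t i) * ip (fun x => g (affApp T x))
            (fun z => MvPolynomial.eval (affApp (Matrix.diagonal t, 0) z) P) := by
          simp only [A, hL, ip, map_sum, MvPolynomial.eval_monomial, affApp,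
            MvPolynomial.eval_eq' _ P, add_zero, Matrix.mulVec_diagonal, mul_pow,
            Finset.prod_mul_distrib, Finset.mul_sum]
          rw [Finset.sum_comm]
          refine Finset.sum_congr rfl fun z _ => Finset.sum_congr rfl fun m _ => ?_
          rw [Finsupp.prod_fintype _ _ (by simp)]
          simp only [Finsupp.add_apply, s, pow_add, Finset.prod_mul_distrib,
            Finsupp.equivFunOnFinite_symm_apply_apply, pow_one]
          ring
        rw [this, h0, mul_zero]
      · push Not at ht
        obtain ⟨i, hi⟩ := ht
        simp only [A, map_sum, MvPolynomial.eval_monomial]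
        refine Finset.sum_eq_zero fun m _ => ?_
        rw [Finsupp.prod_fintype _ _ (by simp), Finset.prod_eq_zero (mem_univ i), mul_zero]
        simp [hi, s]
    · refine Submodule.sum_mem _ fun m hm => ?_
      rw [MvPolynomial.mem_restrictDegree]
      intro d hd i
      obtain rfl := Finset.mem_singleton.1 (MvPolynomial.support_monomial_subset hd)
      have := hP m hm i
      simp only [Finsupp.add_apply, s, Finsupp.equivFunOnFinite_symm_apply_apply]
      omega
  have hcoeff : A.coeff (b + s) = P.coeff b * L b := by
    simp only [A, MvPolynomial.coeff_sum, MvPolynomial.coeff_monomial, add_left_inj]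
    rw [Finset.sum_ite_eq' P.support b, if_pos hb]
  rw [hA, MvPolynomial.coeff_zero] at hcoeff
  exact (mul_eq_zero.1 hcoeff.symm).resolve_left (MvPolynomial.mem_support_iff.1 hb)

theorem prod_pow_of_sum_le {N : ℕ} (hN : N < Fintype.card F)
    (hchoose : ∀ h ≤ N, (N.choose h : F) ≠ 0) (hf : AffOrthogonal g (fun z => ∏ i, z i ^ N))
    (c : Fin n → ℕ) (hc : ∑ i, c i ≤ n * N) : AffOrthogonal g (fun z => ∏ i, z i ^ c i) := by
  induction hd : ∑ i, ((c i - N) + (N - c i)) using Nat.strong_induction_on generalizing c with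
  | _ d ih =>
  subst hd
  have hconst : n * N = ∑ _i : Fin n, N := by simp
  by_cases hlt : ∃ j, c j < N
  · obtain ⟨j, hj⟩ := hlt
    by_cases hgt : ∃ i, N < c i
    · obtain ⟨i, hi⟩ := hgt
      have hij : i ≠ j := by rintro rfl; omega
      set c' := Function.update (Function.update c j N) i (c i - (N - c j)) with hc'
      have hi' : i ∈ univ.erase j := by simp [hij]
      have hcj : c' j = N := by simp [hc', hij.symm]
      have hci : c' i = c i - (N - c j) := by simp [hc']
      have hrest (l : Fin n) (hl : l ∈ (univ.erase j).erase i) : c' l = c l := by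
        simp only [Finset.mem_erase] at hl
        simp [hc', hl.1, hl.2.1]
      have hsplit (φ : Fin n → ℕ) :
          ∑ l, φ l = φ j + (φ i + ∑ l ∈ (univ.erase j).erase i, φ l) := by
        rw [Finset.add_sum_erase _ _ hi', Finset.add_sum_erase _ _ (mem_univ j)]
      have key := transvect hij (h := N - c j) (c := c') (by omega)
        (ih _ ?_ c' ?_ rfl) (by omega) (by rw [hcj]; exact hchoose _ (by omega))
      · convert key using 5 with z l
        rcases eq_or_ne l i with rfl | hli
        · rw [Function.update_self]; omega
        · rcases eq_or_ne l j with rfl | hlj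
          · rw [Function.update_of_ne hli, Function.update_self]; omega
          · rw [Function.update_of_ne hli, Function.update_of_ne hlj,
              hrest l (by simp [hli, hlj])]
      · rw [hsplit, hsplit (fun l => c l - N + (N - c l)), hcj, hci,
          Finset.sum_congr rfl fun l hl => by rw [hrest l hl]]
        omega
      · rw [hsplit] at hc ⊢
        have hsum : ∑ l ∈ (univ.erase j).erase i, c' l = ∑ l ∈ (univ.erase j).erase i, c l :=
          Finset.sum_congr rfl hrest
        rw [hcj, hci, hsum]
        omega
    · push Not at hgt
      have key := translate (j := j) (h := N - c j) (c := Function.update c j N)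
        (by simpa using hN) (ih _ ?_ _ ?_ rfl) (by simp)
        (by rw [Function.update_self]; exact hchoose _ (by omega))
      · convert key using 5 with z l
        rcases eq_or_ne l j with rfl | hlj
        · simp only [Function.update_self]; omega
        · simp [hlj]
      · refine Finset.sum_lt_sum (fun l _ => ?_) ⟨j, mem_univ j, ?_⟩
        · rcases eq_or_ne l j with rfl | hlj
          · simp
          · simp [hlj]
        · simp only [Function.update_self]; omega
      · rw [hconst]
        refine Finset.sum_le_sum fun l _ => ?_
        rcases eq_or_ne l j with rfl | hlj
        · simp
        · simpa [hlj] using hgt l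
  · push Not at hlt
    rw [hconst] at hc
    have heq := (Finset.sum_eq_sum_iff_of_le fun i _ => hlt i).1
      (le_antisymm (Finset.sum_le_sum fun i _ => hlt i) hc)
    convert hf using 4 with z l
    exact (heq l (mem_univ l)).symm

end AffOrthogonal

theorem exists_reduced_eval_eq {F : Type} [Field F] [Fintype F] {n : ℕ} (g : (Fin n → F) → F) :
    ∃ Q : MvPolynomial (Fin n) F, (∀ m ∈ Q.support, ∀ i, m i ≤ Fintype.card F - 1) ∧
      ∀ x, MvPolynomial.eval x Q = g x := by
  have hg : g ∈ (MvPolynomial.restrictDegree (Fin n) F (Fintype.card F - 1)).map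
      (MvPolynomial.evalₗ F (Fin n)) := by
    rw [MvPolynomial.map_restrict_dom_evalₗ]; trivial
  obtain ⟨Q, hQ, rfl⟩ := hg
  exact ⟨Q, fun m hm i => (MvPolynomial.mem_restrictDegree _ _ _).1 hQ m hm i, fun x => rfl⟩

/-- A function orthogonal to every affine image of `(x_1 ⋯ x_p) ^ (p ^ k - 1)` over the field with
`p ^ (k + 1)` elements has degree less than `p ^ (k + 1) * (p - 1)`. -/
theorem AffOrthogonal.exists_totalDegree_lt {F : Type} [Field F] [Fintype F] {p k : ℕ}
    [CharP F p] (hp : p.Prime) (hcard : Fintype.card F = p ^ (k + 1)) {g : (Fin p → F) → F}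
    (hf : AffOrthogonal g (fun z => ∏ i, z i ^ (p ^ k - 1))) :
    ∃ Q : MvPolynomial (Fin p) F, (∀ x, MvPolynomial.eval x Q = g x) ∧
      Q.totalDegree < p ^ (k + 1) * (p - 1) := by
  obtain ⟨Q, hQdeg, hQ⟩ := exists_reduced_eval_eq g
  refine ⟨Q, hQ, ?_⟩
  have h0 : 0 < p ^ k := Nat.pow_pos hp.pos
  have h2 := hp.two_le
  have hN : p ^ k - 1 < Fintype.card F := by
    rw [hcard, pow_succ]; nlinarith [Nat.sub_le (p ^ k) 1]
  rw [MvPolynomial.totalDegree, Finset.sup_lt_iff (by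
    rw [bot_eq_zero]; exact Nat.mul_pos (Nat.pow_pos hp.pos) (by omega))]
  intro m hm
  rw [Finsupp.sum_fintype _ _ (by simp)]
  by_contra! hge
  have hle := hQdeg m hm
  let c : Fin p →₀ ℕ := Finsupp.equivFunOnFinite.symm fun i => Fintype.card F - 1 - m i
  have hmc (i : Fin p) : m i + c i = Fintype.card F - 1 := by
    have := hle i
    simp only [c, Finsupp.equivFunOnFinite_symm_apply_apply]
    omega
  have hsum : ∑ i, m i + ∑ i, c i = p * (Fintype.card F - 1) := by
    simp [← Finset.sum_add_distrib, hmc]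
  have hcsum : ∑ i, c i ≤ p * (p ^ k - 1) := by
    rw [hcard] at hsum
    rw [Nat.mul_sub, mul_one] at hge hsum ⊢
    rw [← pow_succ']
    rw [mul_comm p] at hsum
    omega
  have hm1 (i : Fin p) : 1 ≤ m i := by
    have h1 : c i ≤ ∑ i, c i := Finset.single_le_sum (fun _ _ => Nat.zero_le _) (mem_univ i)
    have h2 := hmc i
    rw [Nat.mul_sub, ← pow_succ', ← hcard] at hcsum
    have h3 : 1 < Fintype.card F := Fintype.one_lt_card
    omega
  have h := hf.prod_pow_of_sum_le hN (fun h hh => by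
    rw [Ne, CharP.cast_eq_zero_iff F p]
    exact hp.not_dvd_pow_sub_one_choose k h hh) c hcsum (1, 0) isUnit_one
  simp only [affApp, Matrix.one_mulVec, add_zero, ← hQ] at h
  rw [ip_eval_mono Q hQdeg m c hm1 hmc] at h
  exact MvPolynomial.mem_support_iff.1 hm ((mul_eq_zero.1 h).resolve_left (by simp))

/-- If `g : F_q^p → F_q` has degree at least `q(p-1)`, then (1) there is an
invertible affine change of variables `T₁` after which the reduced polynomial representing
`g∘T₁` contains a monomial with all individual degrees in `[q - q/p, q-1]`, and (2) there is
an invertible affine `T₂` with `⟨g∘T₂, P⟩ ≠ 0`. -/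
theorem high_degree_rejected_by_P
    (p k : ℕ) (hp : p.Prime) (hk : 1 ≤ k)
    (F : Type) [Field F] [Fintype F]
    (q : ℕ) (hq : q = p ^ k) (hcard : Fintype.card F = q)
    (P : MvPolynomial (Fin p) F) (hP : Pdef p q hp.pos P)
    (g : (Fin p → F) → F)
    (hg : ∀ Q : MvPolynomial (Fin p) F, (∀ x, MvPolynomial.eval x Q = g x) →
      q * (p - 1) ≤ Q.totalDegree) :
    (∃ T₁ : Aff F p p, IsUnit T₁.1 ∧
      ∃ Q : MvPolynomial (Fin p) F,
        (∀ m ∈ Q.support, ∀ i : Fin p, m i ≤ q - 1) ∧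
        (∀ x, MvPolynomial.eval x Q = g (affApp T₁ x)) ∧
        ∃ e : Fin p →₀ ℕ, Q.coeff e ≠ 0 ∧ ∀ i : Fin p, q - q / p ≤ e i ∧ e i ≤ q - 1) ∧
    (∃ T₂ : Aff F p p, IsUnit T₂.1 ∧
      ip (fun x => g (affApp T₂ x)) (fun x => MvPolynomial.eval x P) ≠ 0) := by
  obtain ⟨k, rfl⟩ : ∃ l, k = l + 1 := ⟨k - 1, by omega⟩
  subst hq
  have : Fact p.Prime := ⟨hp⟩
  have : CharP F p := charP_of_card_eq_prime_pow (by rw [hcard])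
  have h0 : 0 < p ^ k := Nat.pow_pos hp.pos
  have hlt : p ^ k < p ^ (k + 1) := Nat.pow_lt_pow_succ hp.one_lt
  have hdiv : p ^ (k + 1) / p = p ^ k := by rw [pow_succ, Nat.mul_div_cancel _ hp.pos]
  have hnot : ¬ AffOrthogonal g (fun z => ∏ i, z i ^ (p ^ k - 1)) := fun hf => by
    obtain ⟨Q, hQ, hlt⟩ := hf.exists_totalDegree_lt hp hcard
    exact (hg Q hQ).not_gt hlt
  let b : Fin p →₀ ℕ := Finsupp.equivFunOnFinite.symm fun _ => p ^ k - 1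
  let e : Fin p →₀ ℕ := Finsupp.equivFunOnFinite.symm fun _ => p ^ (k + 1) - p ^ k
  constructor
  · simp only [AffOrthogonal, not_forall] at hnot
    obtain ⟨T, hT, hne⟩ := hnot
    obtain ⟨Q, hQdeg, hQ⟩ := exists_reduced_eval_eq (fun x => g (affApp T x))
    refine ⟨T, hT, Q, hcard ▸ hQdeg, hQ, e, fun h => hne ?_, fun i => ?_⟩
    · have := ip_eval_mono Q hQdeg e b (fun i => Nat.sub_pos_of_lt hlt) (fun i => by
        simp only [e, b, hcard, Finsupp.equivFunOnFinite_symm_apply_apply]; omega)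
      rw [h, mul_zero] at this
      simp only [hQ] at this
      exact this
    · simp only [e, hdiv, Finsupp.equivFunOnFinite_symm_apply_apply]
      omega
  · by_contra! hall
    have hP' : AffOrthogonal g (fun z => MvPolynomial.eval z P) := hall
    exact hnot (hP'.monomial_of_eval (b := b)
      (fun m hm i => hcard ▸ hP.lt_of_mem_support hp.two_le hm i)
      (MvPolynomial.mem_support_iff.2 (hP.coeff_const_ne_zero hp b fun _ => rfl)))

end
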